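/- Let m ≥ 2 and d ≥ 2. Consider the set S = {1,...,m}^d and two injections φ₁, φ₂ : S → {1,...,m+1}^d defined by incrementing coordinate p and coordinate q respectively, with p ≠ q. Then φ₁(S) ∪ φ₂(S) ⊆ {1,...,m+1}^d and |φ₁(S) ∩ φ₂(S)| = m^(d-2)·(m-1)², so |φ₁(S) ∪ φ₂(S)| = 2m^d - m^(d-2)(m-1)² ≤ (m+1)^d. -/

import Mathlib

open Finset

/-- The box `{1,…,m}^d` of exponent tuples. -/
def expBox (m d : ℕ) : Finset (Fin d → ℕ) :=
  Fintype.piFinset (fun _ : Fin d => Finset.Icc 1 m)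

/-- Shift (increment by one) the coordinate `p` of an exponent tuple. -/
def shiftAt {d : ℕ} (p : Fin d) (f : Fin d → ℕ) : Fin d → ℕ :=
  Function.update f p (f p + 1)

theorem shiftAt_injective {d : ℕ} (p : Fin d) : Function.Injective (shiftAt p) := by
  intro f g h
  funext i
  have hi := congrFun h i
  rcases eq_or_ne i p with rfl | hip
  · simpa [shiftAt] using hi
  · simpa [shiftAt, hip] using hi

theorem card_expBox (m d : ℕ) : (expBox m d).card = m ^ d := by
  simp [expBox]

theorem image_shiftAt_expBox (m d : ℕ) (p : Fin d) :
    (expBox m d).image (shiftAt p) =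
      Fintype.piFinset (fun i => if i = p then Finset.Icc 2 (m + 1) else Finset.Icc 1 m) := by
  ext g
  simp only [mem_image, expBox, Fintype.mem_piFinset, Finset.mem_Icc]
  constructor
  · rintro ⟨f, hf, rfl⟩ i
    have hi := hf i
    rcases eq_or_ne i p with rfl | hip
    · simp [shiftAt]
      omega
    · simpa [shiftAt, hip] using hi
  · intro hg
    have hp := hg p
    simp only [if_true, Finset.mem_Icc] at hp
    refine ⟨Function.update g p (g p - 1), fun i => ?_, ?_⟩
    · have hi := hg i
      rcases eq_or_ne i p with rfl | hip
      · simp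
        omega
      · simpa [hip] using hi
    · simp [shiftAt, Nat.sub_add_cancel (show 1 ≤ g p by omega)]

theorem image_shiftAt_subset (m d : ℕ) (p : Fin d) :
    (expBox m d).image (shiftAt p) ⊆ expBox (m + 1) d := by
  rw [image_shiftAt_expBox]
  refine Fintype.piFinset_subset _ _ fun i => ?_
  split_ifs <;> exact Finset.Icc_subset_Icc (by omega) (by omega)

theorem image_shiftAt_inter (m d : ℕ) {p q : Fin d} (hpq : p ≠ q) :
    (expBox m d).image (shiftAt p) ∩ (expBox m d).image (shiftAt q) =
      Fintype.piFinset
        (fun i => if i ∈ ({p, q} : Finset (Fin d)) then Finset.Icc 2 m else Finset.Icc 1 m) := by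
  rw [image_shiftAt_expBox, image_shiftAt_expBox]
  ext g
  simp only [Finset.mem_inter, Fintype.mem_piFinset, ← forall_and]
  refine forall_congr' fun i => ?_
  rcases eq_or_ne i p with rfl | hip
  · simp [hpq]
    omega
  · rcases eq_or_ne i q with rfl | hiq
    · simp [hip]
      omega
    · simp [hip, hiq]

theorem card_image_shiftAt_inter (m d : ℕ) {p q : Fin d} (hpq : p ≠ q) :
    ((expBox m d).image (shiftAt p) ∩ (expBox m d).image (shiftAt q)).card =
      m ^ (d - 2) * (m - 1) ^ 2 := by
  have hcard (i : Fin d) :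
      (if i ∈ ({p, q} : Finset (Fin d)) then Finset.Icc 2 m else Finset.Icc 1 m).card =
        if i ∈ ({p, q} : Finset (Fin d)) then m - 1 else m := by
    split_ifs <;> simp
  rw [image_shiftAt_inter m d hpq, Fintype.card_piFinset, Finset.prod_congr rfl fun i _ => hcard i,
    Finset.prod_ite, Finset.prod_const, Finset.prod_const, Finset.filter_univ_mem,
    Finset.filter_notMem_eq_sdiff, ← Finset.compl_eq_univ_sdiff, Finset.card_compl,
    Finset.card_pair hpq, Fintype.card_fin, mul_comm]

/-- Abstract combinatorial version of simultaneous alignment: for `m ≥ 2`,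
`d ≥ 2` and two distinct coordinates `p ≠ q`, the shifted copies
`φ₁(S), φ₂(S)` of `S = {1,…,m}^d` lie inside `{1,…,m+1}^d`, their
intersection has cardinality `m^(d-2) (m-1)²`, and their union has
cardinality `2 m^d - m^(d-2) (m-1)² ≤ (m+1)^d`. -/
theorem stmt15 (m d : ℕ) (hm : 2 ≤ m) (hd : 2 ≤ d) (p q : Fin d) (hpq : p ≠ q) :
    ((expBox m d).image (shiftAt p) ∪ (expBox m d).image (shiftAt q)
        ⊆ expBox (m + 1) d)
    ∧ ((expBox m d).image (shiftAt p) ∩ (expBox m d).image (shiftAt q)).card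
        = m ^ (d - 2) * (m - 1) ^ 2
    ∧ ((expBox m d).image (shiftAt p) ∪ (expBox m d).image (shiftAt q)).card
        = 2 * m ^ d - m ^ (d - 2) * (m - 1) ^ 2
    ∧ 2 * m ^ d - m ^ (d - 2) * (m - 1) ^ 2 ≤ (m + 1) ^ d := by
  have hsub := Finset.union_subset (image_shiftAt_subset m d p) (image_shiftAt_subset m d q)
  have hinter := card_image_shiftAt_inter m d hpq
  have hunion : ((expBox m d).image (shiftAt p) ∪ (expBox m d).image (shiftAt q)).card
      = 2 * m ^ d - m ^ (d - 2) * (m - 1) ^ 2 := by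
    rw [Finset.card_union, hinter, Finset.card_image_of_injective _ (shiftAt_injective p),
      Finset.card_image_of_injective _ (shiftAt_injective q), card_expBox, two_mul]
  refine ⟨hsub, hinter, hunion, ?_⟩
  rw [← hunion, ← card_expBox (m + 1) d]
  exact Finset.card_le_card hsub
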